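/- Let K be any field of characteristic 2, and let a and b be two distinct non-constant polynomials in K[t]. Let α_p ∈ K((1/t)) be the value of the infinite continued fraction whose sequence of partial quotients is the (a,b)-period-doubling sequence. Then A·α_p^4 + B·α_p^3 + C·α_p^2 + 1 = 0, where A = ab + b^2 + 1, B = ab(a + b), and C = ab. -/

import Mathlib

/-- The continuant `⟨W⟩` of a finite word `W` with letters in a commutative ring,
defined by `⟨∅⟩ = 1`, `⟨w⟩ = w` and `⟨W⟩ = w₁⟨W'⟩ + ⟨(W')'⟩`, where `W'` is `W`
with its first letter deleted. -/
def continuant {R : Type*} [CommRing R] : List R → R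
  | [] => 1
  | [x] => x
  | x :: y :: l => x * continuant (y :: l) + continuant l

/-- The `(a,b)`-period-doubling sequence: the `n`-th term is `a` when the 2-adic
valuation of `n+1` is even, and `b` when it is odd.  (This is the fixed point
`σ^∞(a)` of the morphism `σ(a) = ab`, `σ(b) = aa`.) -/
def pdSeq {X : Type*} (a b : X) (n : ℕ) : X :=
  if Even (padicValNat 2 (n + 1)) then a else b

/-- The element `t` of `K((1/t))`, realized in `LaurentSeries K` whose
variable `X` stands for `1/t`; thus `t = X⁻¹` is the Hahn series `single (-1) 1`. -/
noncomputable def tt (K : Type*) [Field K] : LaurentSeries K := HahnSeries.single (-1 : ℤ) 1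

/-- The word of the first `n` partial quotients of the period-doubling continued
fraction, viewed inside `K((1/t))`. -/
noncomputable def pdQuotients {K : Type*} [Field K] (a b : Polynomial K) (n : ℕ) :
    List (LaurentSeries K) :=
  (List.range n).map fun i => Polynomial.aeval (tt K) (pdSeq a b i)

/-- The `n`-th convergent `[p₀; p₁, …, pₙ]` of the period-doubling continued
fraction, expressed as the quotient of continuants `⟨p₀,…,pₙ⟩ / ⟨p₁,…,pₙ⟩`. -/
noncomputable def pdConvergent {K : Type*} [Field K] (a b : Polynomial K) (n : ℕ) :
    LaurentSeries K :=
  continuant (pdQuotients a b (n + 1)) / continuant (pdQuotients a b (n + 1)).tail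

open WithZero

/-- The product of the elementary matrices attached to the letters of a word. -/
def wordMatrix {R : Type*} [CommRing R] (l : List R) : Matrix (Fin 2) (Fin 2) R :=
  (l.map fun x => !![x, 1; 1, 0]).prod

section Continuant

variable {R : Type*} [CommRing R]

lemma wordMatrix_append (l l' : List R) :
    wordMatrix (l ++ l') = wordMatrix l * wordMatrix l' := by
  simp [wordMatrix]

lemma wordMatrix_cons (x : R) (l : List R) :
    wordMatrix (x :: l) = !![x, 1; 1, 0] * wordMatrix l := by
  simp [wordMatrix]

lemma wordMatrix_cons_one_zero (x : R) (l : List R) :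
    wordMatrix (x :: l) 1 0 = wordMatrix l 0 0 := by
  simp [wordMatrix_cons, Matrix.mul_apply, Fin.sum_univ_two]

lemma wordMatrix_zero_zero (l : List R) : wordMatrix l 0 0 = continuant l := by
  induction l using continuant.induct with
  | case1 => simp [wordMatrix, continuant]
  | case2 x => simp [wordMatrix, continuant]
  | case3 x y l ih₁ ih₂ =>
    rw [wordMatrix_cons, Matrix.mul_apply, Fin.sum_univ_two, wordMatrix_cons_one_zero, ih₁, ih₂]
    simp [continuant]

lemma wordMatrix_one_zero {l : List R} (hl : l ≠ []) :
    wordMatrix l 1 0 = continuant l.tail := by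
  cases l with
  | nil => exact absurd rfl hl
  | cons x l => rw [wordMatrix_cons_one_zero, wordMatrix_zero_zero, List.tail_cons]

end Continuant

lemma padicValNat_two_pow_add {k j : ℕ} (hj : 0 < j) (hjk : j < 2 ^ k) :
    padicValNat 2 (2 ^ k + j) = padicValNat 2 j := by
  have key : ∀ i, 2 ^ i ∣ 2 ^ k + j ↔ 2 ^ i ∣ j := by
    intro i
    rcases le_total i k with h | h
    · exact Nat.dvd_add_right (pow_dvd_pow 2 h)
    · have hn : ¬ 2 ^ k ∣ j := fun hd => absurd (Nat.le_of_dvd hj hd) (by omega)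
      constructor
      · intro hd
        exact absurd ((Nat.dvd_add_right dvd_rfl).1 ((pow_dvd_pow 2 h).trans hd)) hn
      · intro hd
        exact absurd ((pow_dvd_pow 2 h).trans hd) hn
  apply le_antisymm
  · rw [← padicValNat_dvd_iff_le hj.ne', ← key]
    exact pow_padicValNat_dvd
  · rw [← padicValNat_dvd_iff_le (by omega), key]
    exact pow_padicValNat_dvd

section PeriodDoubling

variable {X : Type*} (a b : X)

lemma pdSeq_two_pow_add {k i : ℕ} (hi : i < 2 ^ k - 1) :
    pdSeq a b (2 ^ k + i) = pdSeq a b i := by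
  unfold pdSeq
  rw [add_assoc, padicValNat_two_pow_add (by omega) (by omega)]

lemma pdSeq_two_pow_sub_one (k : ℕ) :
    pdSeq a b (2 ^ k - 1) = if Even k then a else b := by
  unfold pdSeq
  rw [Nat.sub_add_cancel Nat.one_le_two_pow, padicValNat.prime_pow]

/-- The prefix of length `2 ^ k - 1` of the period-doubling sequence. -/
def pdWord (k : ℕ) : List X := (List.range (2 ^ k - 1)).map (pdSeq a b)

lemma pdWord_succ (k : ℕ) :
    pdWord a b (k + 1) =
      pdWord a b k ++ ((if Even k then a else b) :: pdWord a b k) := by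
  have h1 : 2 ^ (k + 1) - 1 = (2 ^ k - 1 + 1) + (2 ^ k - 1) := by
    have := Nat.one_le_two_pow (n := k)
    rw [pow_succ]
    omega
  have h2 : 2 ^ k - 1 + 1 = 2 ^ k := Nat.sub_add_cancel Nat.one_le_two_pow
  unfold pdWord
  rw [h1, List.range_add, List.range_succ, List.map_append, List.map_append, List.map_map,
    List.append_assoc]
  congr 1
  simp only [List.map_cons, List.map_nil, List.singleton_append, pdSeq_two_pow_sub_one, h2]
  congr 1
  apply List.map_congr_left
  intro i hi
  exact pdSeq_two_pow_add a b (List.mem_range.1 hi)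

end PeriodDoubling

lemma wordMatrix_pdWord_succ {R : Type*} [CommRing R] (h2 : (2 : R) = 0) (a b : R) {k : ℕ}
    {c q r s : R} (hc : (if Even k then a else b) = c)
    (hM : wordMatrix (pdWord a b k) = !![q, r; r, s]) (hdet : q * s = r ^ 2 + 1) :
    wordMatrix (pdWord a b (k + 1)) =
      !![c * q ^ 2, c * q * r + 1; c * q * r + 1, c * r ^ 2] := by
  rw [pdWord_succ, hc, wordMatrix_append, wordMatrix_cons, hM]
  ext i j
  fin_cases i <;> fin_cases j <;> simp [Matrix.mul_apply, Fin.sum_univ_two]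
  · linear_combination q * r * h2
  · linear_combination hdet + r ^ 2 * h2
  · linear_combination hdet + r ^ 2 * h2
  · linear_combination r * s * h2

section Valuation

lemma valuation_sq_div_le {L : Type*} [Field L] (v : Valuation L ℤᵐ⁰) {y c : L}
    (hy : v y ≤ 1) (hc : exp 1 ≤ v c) : v (y ^ 2 / c) ≤ v y * exp (-1) := by
  have h : (v c)⁻¹ ≤ exp (-1) := by
    rw [exp_neg]
    exact inv_anti₀ exp_pos hc
  rw [map_div₀, map_pow, div_eq_mul_inv, sq]
  exact mul_le_mul' (mul_le_of_le_one_right' hy) h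

lemma valuation_tt (K : Type*) [Field K] :
    (Valued.v : Valuation (LaurentSeries K) ℤᵐ⁰) (tt K) = exp 1 := by
  rw [tt, LaurentSeries.valuation_single_zpow, neg_neg]

lemma valuation_algebraMap {K : Type*} [Field K] {c : K} (hc : c ≠ 0) :
    (Valued.v : Valuation (LaurentSeries K) ℤᵐ⁰) (algebraMap K (LaurentSeries K) c) = 1 := by
  have hle : ∀ d : K,
      (Valued.v : Valuation (LaurentSeries K) ℤᵐ⁰) (algebraMap K (LaurentSeries K) d) ≤ 1 := by
    intro d
    rw [LaurentSeries.val_le_one_iff_eq_coe]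
    exact ⟨algebraMap K (PowerSeries K) d, (HahnSeries.algebraMap_apply' ℤ d).symm⟩
  apply le_antisymm (hle c)
  have h := hle c⁻¹
  rw [map_inv₀, map_inv₀] at h
  exact (inv_le_one₀ (by simp [zero_lt_iff, hc])).1 h

lemma valuation_aeval_tt {K : Type*} [Field K] {f : Polynomial K} (hf : f ≠ 0) :
    (Valued.v : Valuation (LaurentSeries K) ℤᵐ⁰) (Polynomial.aeval (tt K) f) =
      exp (f.natDegree : ℤ) := by
  have hpow : ∀ n : ℕ, (Valued.v : Valuation (LaurentSeries K) ℤᵐ⁰) (tt K ^ n) =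
      exp (n : ℤ) := by
    intro n
    rw [map_pow, valuation_tt, ← exp_nsmul, nsmul_one]
  rw [Polynomial.aeval_def, Polynomial.eval₂_eq_sum_range, Finset.sum_range_succ]
  have hlead : (Valued.v : Valuation (LaurentSeries K) ℤᵐ⁰)
      (algebraMap K _ (f.coeff f.natDegree) * tt K ^ f.natDegree) = exp (f.natDegree : ℤ) := by
    rw [map_mul, valuation_algebraMap (by simpa using hf), one_mul, hpow]
  rw [Valuation.map_add_eq_of_lt_right, hlead]
  rw [hlead]
  apply Valuation.map_sum_lt _ exp_ne_zero
  intro i hi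
  by_cases h : f.coeff i = 0
  · simp [h, exp_pos]
  · rw [map_mul, valuation_algebraMap h, one_mul, hpow, exp_lt_exp]
    exact_mod_cast Finset.mem_range.1 hi

end Valuation

/-- The matrices of the prefixes of odd level, together with a splitting `O + E` of the inverse
`r / q` of the convergent into two parts interchanged by squaring up to an error `y ^ 2`. -/
lemma exists_pdWord_splitting {L : Type*} [Field L] (h2 : (2 : L) = 0) (v : Valuation L ℤᵐ⁰)
    {a b : L} (ha : exp 1 ≤ v a) (hb : exp 1 ≤ v b) (m : ℕ) :
    ∃ q r s O E y : L, wordMatrix (pdWord a b (2 * m + 1)) = !![q, r; r, s] ∧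
      q * s = r ^ 2 + 1 ∧ y * q = 1 ∧ r * y = O + E ∧ O ^ 2 = b * E + y ^ 2 ∧
      E ^ 2 = a * O + 1 ∧ v y ≤ (v a)⁻¹ * exp (-1) ^ m ∧ v (O + E) = (v a)⁻¹ := by
  have hva : v a ≠ 0 := (exp_pos.trans_le ha).ne'
  have ha0 : a ≠ 0 := fun h => hva (by simp [h])
  have hb0 : b ≠ 0 := fun h => (exp_pos.trans_le hb).ne' (by simp [h])
  have he : (exp (-1) : ℤᵐ⁰) < 1 := by rw [← exp_zero, exp_lt_exp]; norm_num
  have hva1 : (v a)⁻¹ ≤ 1 := by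
    apply inv_le_one_of_one_le₀
    refine le_trans ?_ ha
    rw [← exp_zero, exp_le_exp]
    norm_num
  have hva0 : 0 < (v a)⁻¹ := zero_lt_iff.2 (inv_ne_zero hva)
  induction m with
  | zero =>
    refine ⟨a, 1, 0, a⁻¹, 0, a⁻¹, ?_, ?_, ?_, ?_, ?_, ?_, ?_, ?_⟩
    · simp [pdWord, wordMatrix, pdSeq]
    · linear_combination -h2
    · exact inv_mul_cancel₀ ha0
    · ring
    · ring
    · rw [mul_inv_cancel₀ ha0]
      linear_combination -h2
    · simp
    · simp
  | succ m ih =>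
    obtain ⟨q, r, s, O, E, y, hM, hdet, hyq, hry, hO, hE, hvy, hvu⟩ := ih
    have hM₁ := wordMatrix_pdWord_succ h2 a b (k := 2 * m + 1) (c := b) (by simp) hM hdet
    have hM₂ := wordMatrix_pdWord_succ h2 a b (c := a)
      (if_pos (by simp [parity_simps])) hM₁
      (by linear_combination (-b * q * r - 1) * h2)
    have hy1 : v y ≤ 1 := hvy.trans (mul_le_one' hva1 (pow_le_one' he.le m))
    have hv₁ := valuation_sq_div_le v hy1 hb
    have hv₁' : v (y ^ 2 / b) ≤ v y := hv₁.trans (mul_le_of_le_one_right' he.le)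
    have hv₂ := valuation_sq_div_le v (hv₁'.trans hy1) ha
    have hlt : v (y ^ 2 / b) < (v a)⁻¹ := by
      refine hv₁.trans_lt ?_
      calc v y * exp (-1) ≤ (v a)⁻¹ * exp (-1) :=
            mul_le_mul_left (hvy.trans (mul_le_of_le_one_right' (pow_le_one' he.le m))) _
        _ < (v a)⁻¹ := mul_lt_of_lt_one_right hva0 he
    have hle₂ : v ((y ^ 2 / b) ^ 2 / a) ≤ v (y ^ 2 / b) :=
      hv₂.trans (mul_le_of_le_one_right' he.le)
    have hq0 : q ≠ 0 := right_ne_zero_of_mul_eq_one hyq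
    have hy : y = q⁻¹ := eq_inv_of_mul_eq_one_left hyq
    refine ⟨_, _, _, O + (y ^ 2 / b) ^ 2 / a, E + y ^ 2 / b, (y ^ 2 / b) ^ 2 / a, hM₂,
      ?_, ?_, ?_, ?_, ?_, ?_, ?_⟩
    · linear_combination (-(a * b * q ^ 2 * (b * q * r + 1)) - 1) * h2
    · rw [hy]
      field_simp
    · have h : O + (y ^ 2 / b) ^ 2 / a + (E + y ^ 2 / b) =
          r * y + (y ^ 2 / b) ^ 2 / a + y ^ 2 / b := by rw [hry]; ring
      rw [h, hy]
      field_simp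
      ring
    · linear_combination hO + O * ((y ^ 2 / b) ^ 2 / a) * h2 - mul_div_cancel₀ (y ^ 2) hb0
    · linear_combination hE + E * (y ^ 2 / b) * h2 - mul_div_cancel₀ ((y ^ 2 / b) ^ 2) ha0
    · calc v ((y ^ 2 / b) ^ 2 / a) ≤ v (y ^ 2 / b) * exp (-1) := hv₂
        _ ≤ ((v a)⁻¹ * exp (-1) ^ m) * exp (-1) := mul_le_mul_left (hv₁'.trans hvy) _
        _ = (v a)⁻¹ * exp (-1) ^ (m + 1) := by rw [pow_succ, mul_assoc]
    · have h : O + (y ^ 2 / b) ^ 2 / a + (E + y ^ 2 / b) =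
          (O + E) + ((y ^ 2 / b) ^ 2 / a + y ^ 2 / b) := by ring
      rw [h, Valuation.map_add_eq_of_lt_left, hvu]
      rw [hvu]
      exact v.map_add_lt (hle₂.trans_lt hlt) hlt

lemma quartic_inv_eq_of_splitting {L : Type*} [Field L] (h2 : (2 : L) = 0) {a b O E y : L}
    (hO : O ^ 2 = b * E + y ^ 2) (hE : E ^ 2 = a * O + 1) (hu : O + E ≠ 0) :
    (a * b + b ^ 2 + 1) * (O + E)⁻¹ ^ 4 + a * b * (a + b) * (O + E)⁻¹ ^ 3
      + a * b * (O + E)⁻¹ ^ 2 + 1 =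
      ((a ^ 2 + a * b) * y ^ 2 + y ^ 4) * (O + E)⁻¹ ^ 4 := by
  have hu2 : (O + E) ^ 2 = b * E + y ^ 2 + a * O + 1 := by
    linear_combination hO + hE + O * E * h2
  have hu4 : (O + E) ^ 4 =
      b ^ 2 * (a * O + 1) + a ^ 2 * (b * E + y ^ 2) + y ^ 4 + 1 := by
    linear_combination ((O + E) ^ 2 + (b * E + y ^ 2 + a * O + 1)) * hu2 + b ^ 2 * hE
      + a ^ 2 * hO + (b * E * y ^ 2 + b * E * a * O + b * E + y ^ 2 * a * O + y ^ 2 + a * O) * h2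
  have hF : (a * b + b ^ 2 + 1) + a * b * (a + b) * (O + E) + a * b * (O + E) ^ 2
      + (O + E) ^ 4 = (a ^ 2 + a * b) * y ^ 2 + y ^ 4 := by
    linear_combination hu4 + a * b * hu2 + (b ^ 2 + a * b + 1 + a ^ 2 * b * O + a * b ^ 2 * O
      + a ^ 2 * b * E + a * b ^ 2 * E) * h2
  rw [← hF]
  generalize O + E = u at hu
  field_simp

lemma tendsto_zero_of_valuation_le {K : Type*} [Field K] {y : ℕ → LaurentSeries K}
    (h : ∀ m, (Valued.v : Valuation (LaurentSeries K) ℤᵐ⁰) (y m) ≤ exp (-1) ^ m) :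
    Filter.Tendsto y Filter.atTop (nhds 0) := by
  have hX : (Valued.v : Valuation (LaurentSeries K) ℤᵐ⁰) (HahnSeries.single (1 : ℤ) (1 : K))
      = exp (-1) := LaurentSeries.valuation_single_zpow K 1
  have ht := Valued.tendsto_zero_pow_of_v_lt_one
    (x := (HahnSeries.single (1 : ℤ) (1 : K) : LaurentSeries K))
    (by rw [hX, ← exp_zero, exp_lt_exp]; norm_num)
  rw [(Valued.hasBasis_nhds_zero _ _).tendsto_right_iff] at ht ⊢
  intro γ hγ
  filter_upwards [ht γ hγ] with m hm
  refine lt_of_le_of_lt ?_ hm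
  rw [Valuation.restrict_le_iff, map_pow, hX]
  exact h m

/-- Let `K` be any field of characteristic 2, let `a ≠ b` be non-constant
polynomials in `K[t]` and let `α_p ∈ K((1/t))` be the value of the continued
fraction whose partial quotients form the `(a,b)`-period-doubling sequence.  Then
`A·α_p⁴ + B·α_p³ + C·α_p² + 1 = 0` with `A = ab + b² + 1`, `B = ab(a+b)`, `C = ab`. -/
theorem period_doubling_CF_algebraic_char_two
    (K : Type*) [Field K] [CharP K 2]
    (a b : Polynomial K) (hab : a ≠ b)
    (ha : 0 < a.natDegree) (hb : 0 < b.natDegree)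
    (α : LaurentSeries K)
    (hα : Filter.Tendsto (pdConvergent a b) Filter.atTop (nhds α)) :
    Polynomial.aeval (tt K) (a * b + b ^ 2 + 1) * α ^ 4
      + Polynomial.aeval (tt K) (a * b * (a + b)) * α ^ 3
      + Polynomial.aeval (tt K) (a * b) * α ^ 2 + 1 = 0 := by
  have h2 : (2 : LaurentSeries K) = 0 := by
    have h : (2 : K) = 0 := CharTwo.two_eq_zero
    rw [← map_ofNat (algebraMap K (LaurentSeries K)) 2, h, map_zero]
  have hexp : ∀ f : Polynomial K, 0 < f.natDegree →
      exp 1 ≤ (Valued.v : Valuation (LaurentSeries K) ℤᵐ⁰) (Polynomial.aeval (tt K) f) := by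
    intro f hf
    rw [valuation_aeval_tt (Polynomial.ne_zero_of_natDegree_gt hf), exp_le_exp]
    exact_mod_cast hf
  have hquot : ∀ k, pdQuotients a b (2 ^ k - 1) =
      pdWord (Polynomial.aeval (tt K) a) (Polynomial.aeval (tt K) b) k := by
    intro k
    apply List.map_congr_left
    intro i _
    exact apply_ite _ _ _ _
  simp only [map_add, map_mul, map_pow, map_one]
  have hva := hexp a ha
  have hvb := hexp b hb
  generalize Polynomial.aeval (tt K) a = A at *
  generalize Polynomial.aeval (tt K) b = B at *
  choose q r s O E y hM hdet hyq hry hO hE hvy hvu using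
    exists_pdWord_splitting h2 Valued.v hva hvb
  have hvA : (Valued.v : Valuation (LaurentSeries K) ℤᵐ⁰) A ≠ 0 := (exp_pos.trans_le hva).ne'
  have hu : ∀ m, O m + E m ≠ 0 := by
    intro m h
    have := hvu m
    rw [h, map_zero] at this
    exact inv_ne_zero hvA this.symm
  have hsub : Filter.Tendsto (fun m : ℕ => 2 ^ (2 * m + 1) - 2) Filter.atTop Filter.atTop := by
    refine Filter.tendsto_atTop_mono (fun m => ?_) Filter.tendsto_id
    have := Nat.lt_two_pow_self (n := 2 * m)
    rw [pow_succ, id]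
    omega
  have hconv : ∀ m, pdConvergent a b (2 ^ (2 * m + 1) - 2) = (O m + E m)⁻¹ := by
    intro m
    have hlen : 2 ^ (2 * m + 1) - 2 + 1 = 2 ^ (2 * m + 1) - 1 := by
      have := Nat.one_le_two_pow (n := 2 * m)
      rw [pow_succ]
      omega
    have hne : pdWord A B (2 * m + 1) ≠ [] := by
      rw [pdWord_succ]
      simp
    rw [pdConvergent, hlen, hquot, ← wordMatrix_zero_zero, ← wordMatrix_one_zero hne, hM,
      ← hry, eq_inv_of_mul_eq_one_left (hyq m)]
    simp [div_eq_mul_inv]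
  have hx : Filter.Tendsto (fun m => (O m + E m)⁻¹) Filter.atTop (nhds α) :=
    (hα.comp hsub).congr hconv
  have hy : Filter.Tendsto y Filter.atTop (nhds 0) := by
    refine tendsto_zero_of_valuation_le fun m => (hvy m).trans (mul_le_of_le_one_left' ?_)
    apply inv_le_one_of_one_le₀
    refine le_trans ?_ hva
    rw [← exp_zero, exp_le_exp]
    norm_num
  have hL := ((((hx.pow 4).const_mul (A * B + B ^ 2 + 1)).add
    ((hx.pow 3).const_mul (A * B * (A + B)))).add ((hx.pow 2).const_mul (A * B))).add_const 1
  have hR := (((hy.pow 2).const_mul (A ^ 2 + A * B)).add (hy.pow 4)).mul (hx.pow 4)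
  have heq := tendsto_nhds_unique
    (hL.congr fun m => quartic_inv_eq_of_splitting h2 (hO m) (hE m) (hu m)) hR
  simpa using heq
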